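/- Let m be a probability measure on ℝ with finite moments of all orders, and let M_k(τ) denote the moments of the Rayleigh measure τ associated with m by the Markov–Krein correspondence. Then for every k ≥ 1, Σ_{ρ ∈ NC(k)} (|ρ| − 1) · fc_ρ(m) = Σ_{r=1}^{k−1} M_r(τ) · M_{k−r}(m). -/

import Mathlib

open MeasureTheory Finset
open scoped Classical

/-- `ρ` is a partition of the finite set `S ⊆ ℕ`: its blocks are nonempty subsets of `S`
and every element of `S` lies in exactly one block. -/
def IsPartitionOn (S : Finset ℕ) (ρ : Finset (Finset ℕ)) : Prop :=
  (∀ B ∈ ρ, B.Nonempty) ∧ (∀ B ∈ ρ, B ⊆ S) ∧ (∀ x ∈ S, ∃! B, B ∈ ρ ∧ x ∈ B)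

/-- A family of blocks is non-crossing if no two distinct blocks cross. -/
def IsNoncrossing (ρ : Finset (Finset ℕ)) : Prop :=
  ∀ B ∈ ρ, ∀ C ∈ ρ, B ≠ C →
    ¬ ∃ a b c d : ℕ, a ∈ B ∧ b ∈ B ∧ c ∈ C ∧ d ∈ C ∧ a < c ∧ c < b ∧ b < d

/-- `ρ` is a non-crossing partition of `S`. -/
def IsNCPartitionOn (S : Finset ℕ) (ρ : Finset (Finset ℕ)) : Prop :=
  IsPartitionOn S ρ ∧ IsNoncrossing ρ

/-- `NC(k)`: the finite set of all non-crossing partitions of `{1, …, k}`. -/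
noncomputable def NCFinset (k : ℕ) : Finset (Finset (Finset ℕ)) :=
  ((Finset.Icc 1 k).powerset.powerset).filter (IsNCPartitionOn (Finset.Icc 1 k))

section Partitions

/-- The set of all non-crossing partitions of `S`. -/
noncomputable def ncPartitions (S : Finset ℕ) : Finset (Finset (Finset ℕ)) :=
  S.powerset.powerset.filter (IsNCPartitionOn S)

/-- The block of `ρ` containing `x`, or `∅` if there is none. -/
noncomputable def blockOf (ρ : Finset (Finset ℕ)) (x : ℕ) : Finset ℕ :=
  (ρ.filter (x ∈ ·)).biUnion id

/-- The family of nonempty traces on `T` of the blocks of `ρ`. -/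
noncomputable def restrictBlocks (T : Finset ℕ) (ρ : Finset (Finset ℕ)) : Finset (Finset ℕ) :=
  (ρ.image (· ∩ T)).erase ∅

/-- Add `n` to the block of `σ` containing `p` and adjoin the blocks of `π`. -/
noncomputable def glueAt (n p : ℕ) (σ π : Finset (Finset ℕ)) : Finset (Finset ℕ) :=
  insert (insert n (blockOf σ p)) (σ.filter (p ∉ ·) ∪ π)

/-- The element preceding `n` in its block, or `a` if `n` is the least element of its block. -/
noncomputable def prevInBlock (a n : ℕ) (ρ : Finset (Finset ℕ)) : ℕ :=
  (insert a ((blockOf ρ n).erase n)).max' (insert_nonempty _ _)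

lemma mem_ncPartitions {S : Finset ℕ} {ρ : Finset (Finset ℕ)} :
    ρ ∈ ncPartitions S ↔ IsNCPartitionOn S ρ := by
  simp only [ncPartitions, mem_filter, and_iff_right_iff_imp, mem_powerset]
  exact fun h B hB => mem_powerset.2 (h.1.2.1 B hB)

lemma IsPartitionOn.eq_of_mem {S : Finset ℕ} {ρ : Finset (Finset ℕ)} (h : IsPartitionOn S ρ)
    {B C : Finset ℕ} (hB : B ∈ ρ) (hC : C ∈ ρ) {x : ℕ} (hxB : x ∈ B) (hxC : x ∈ C) : B = C :=
  (h.2.2 x (h.2.1 B hB hxB)).unique ⟨hB, hxB⟩ ⟨hC, hxC⟩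

lemma IsPartitionOn.eq_of_subset {S : Finset ℕ} {ρ ρ' : Finset (Finset ℕ)}
    (h : IsPartitionOn S ρ) (h' : IsPartitionOn S ρ') (hsub : ρ ⊆ ρ') : ρ = ρ' := by
  refine Subset.antisymm hsub fun B hB => ?_
  obtain ⟨x, hx⟩ := h'.1 B hB
  obtain ⟨C, ⟨hC, hxC⟩, -⟩ := h.2.2 x (h'.2.1 B hB hx)
  rwa [h'.eq_of_mem hB (hsub hC) hx hxC]

lemma IsPartitionOn.blockOf_eq {S : Finset ℕ} {ρ : Finset (Finset ℕ)} (h : IsPartitionOn S ρ)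
    {B : Finset ℕ} (hB : B ∈ ρ) {x : ℕ} (hx : x ∈ B) : blockOf ρ x = B := by
  ext y
  simp only [blockOf, mem_biUnion, mem_filter, id]
  exact ⟨fun ⟨C, ⟨hC, hxC⟩, hy⟩ => h.eq_of_mem hC hB hxC hx ▸ hy, fun hy => ⟨B, ⟨hB, hx⟩, hy⟩⟩

lemma IsPartitionOn.blockOf_mem {S : Finset ℕ} {ρ : Finset (Finset ℕ)} (h : IsPartitionOn S ρ)
    {x : ℕ} (hx : x ∈ S) : blockOf ρ x ∈ ρ ∧ x ∈ blockOf ρ x := by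
  obtain ⟨B, ⟨hB, hxB⟩, -⟩ := h.2.2 x hx
  rw [h.blockOf_eq hB hxB]
  exact ⟨hB, hxB⟩

lemma IsPartitionOn.blockOf_eq_empty {S : Finset ℕ} {ρ : Finset (Finset ℕ)}
    (h : IsPartitionOn S ρ) {x : ℕ} (hx : x ∉ S) : blockOf ρ x = ∅ := by
  ext y
  simp only [blockOf, mem_biUnion, mem_filter, id, notMem_empty, iff_false]
  exact fun ⟨C, ⟨hC, hxC⟩, _⟩ => hx (h.2.1 C hC hxC)

lemma IsPartitionOn.blockOf_subset {S : Finset ℕ} {ρ : Finset (Finset ℕ)}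
    (h : IsPartitionOn S ρ) (x : ℕ) : blockOf ρ x ⊆ S := by
  intro y
  simp only [blockOf, mem_biUnion, mem_filter, id]
  exact fun ⟨C, ⟨hC, _⟩, hy⟩ => h.2.1 C hC hy

lemma mem_restrictBlocks {T : Finset ℕ} {ρ : Finset (Finset ℕ)} {B : Finset ℕ} :
    B ∈ restrictBlocks T ρ ↔ B.Nonempty ∧ ∃ C ∈ ρ, C ∩ T = B := by
  simp [restrictBlocks, nonempty_iff_ne_empty]

lemma mem_glueAt {n p : ℕ} {σ π : Finset (Finset ℕ)} {B : Finset ℕ} :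
    B ∈ glueAt n p σ π ↔ B = insert n (blockOf σ p) ∨ (B ∈ σ ∧ p ∉ B) ∨ B ∈ π := by
  simp [glueAt]

lemma IsNCPartitionOn.restrictBlocks {S T : Finset ℕ} {ρ : Finset (Finset ℕ)}
    (h : IsNCPartitionOn S ρ) (hT : T ⊆ S) : IsNCPartitionOn T (restrictBlocks T ρ) := by
  refine ⟨⟨fun B hB => (mem_restrictBlocks.1 hB).1, ?_, ?_⟩, ?_⟩
  · intro B hB
    obtain ⟨-, C, -, rfl⟩ := mem_restrictBlocks.1 hB
    exact inter_subset_right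
  · intro x hx
    obtain ⟨B, ⟨hB, hxB⟩, -⟩ := h.1.2.2 x (hT hx)
    have hxBT : x ∈ B ∩ T := mem_inter.2 ⟨hxB, hx⟩
    refine ⟨B ∩ T, ⟨mem_restrictBlocks.2 ⟨⟨x, hxBT⟩, B, hB, rfl⟩, hxBT⟩, ?_⟩
    rintro D ⟨hD, hxD⟩
    obtain ⟨-, C, hC, rfl⟩ := mem_restrictBlocks.1 hD
    rw [h.1.eq_of_mem hC hB (mem_inter.1 hxD).1 hxB]
  · intro B hB C hC hne
    obtain ⟨-, B, hB', rfl⟩ := mem_restrictBlocks.1 hB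
    obtain ⟨-, C, hC', rfl⟩ := mem_restrictBlocks.1 hC
    rintro ⟨x, y, z, w, hx, hy, hz, hw, hlt⟩
    refine h.2 B hB' C hC' (fun e => hne (by rw [e])) ⟨x, y, z, w, ?_, ?_, ?_, ?_, hlt⟩
    all_goals simp_all only [mem_inter]

lemma isNCPartitionOn_glueAt {a p b : ℕ} (hap : a ≤ p) (hpb : p ≤ b)
    {σ π : Finset (Finset ℕ)} (hσ : IsNCPartitionOn (Ioc a p) σ)
    (hπ : IsNCPartitionOn (Ioc p b) π) :
    IsNCPartitionOn (Ioc a (b + 1)) (glueAt (b + 1) p σ π) := by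
  have hσI : ∀ B ∈ σ, ∀ x ∈ B, a < x ∧ x ≤ p := fun B hB x hx => mem_Ioc.1 (hσ.1.2.1 B hB hx)
  have hπI : ∀ B ∈ π, ∀ x ∈ B, p < x ∧ x ≤ b := fun B hB x hx => mem_Ioc.1 (hπ.1.2.1 B hB hx)
  have hblk : ∀ x ∈ blockOf σ p, a < x ∧ x ≤ p := fun x hx =>
    mem_Ioc.1 (hσ.1.blockOf_subset p hx)
  have hdisj : ∀ B ∈ σ, p ∉ B → ∀ x ∈ B, x ∉ blockOf σ p := by
    intro B hB hp x hx hx'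
    simp only [blockOf, mem_biUnion, mem_filter, id] at hx'
    obtain ⟨C, ⟨hC, hpC⟩, hxC⟩ := hx'
    exact hp (hσ.1.eq_of_mem hB hC hx hxC ▸ hpC)
  refine ⟨⟨?_, ?_, ?_⟩, ?_⟩
  · intro B hB
    rcases mem_glueAt.1 hB with rfl | ⟨hB, -⟩ | hB
    exacts [insert_nonempty _ _, hσ.1.1 B hB, hπ.1.1 B hB]
  · intro B hB x hx
    rw [mem_Ioc]
    rcases mem_glueAt.1 hB with rfl | ⟨hB, -⟩ | hB
    · rcases mem_insert.1 hx with rfl | hx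
      · omega
      · have := hblk x hx; omega
    · have := hσI B hB x hx; omega
    · have := hπI B hB x hx; omega
  · intro x hx
    rw [mem_Ioc] at hx
    have hex : ∃ B, B ∈ glueAt (b + 1) p σ π ∧ x ∈ B := by
      by_cases h1 : x = b + 1
      · exact ⟨_, mem_glueAt.2 (Or.inl rfl), by simp [h1]⟩
      by_cases h2 : x ≤ p
      · obtain ⟨hB, hxB⟩ := hσ.1.blockOf_mem (mem_Ioc.2 ⟨hx.1, h2⟩)
        by_cases hp : p ∈ blockOf σ x
        · refine ⟨_, mem_glueAt.2 (Or.inl rfl), mem_insert_of_mem ?_⟩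
          rwa [hσ.1.blockOf_eq hB hp]
        · exact ⟨_, mem_glueAt.2 (Or.inr (Or.inl ⟨hB, hp⟩)), hxB⟩
      · obtain ⟨hB, hxB⟩ := hπ.1.blockOf_mem (x := x) (mem_Ioc.2 ⟨by omega, by omega⟩)
        exact ⟨_, mem_glueAt.2 (Or.inr (Or.inr hB)), hxB⟩
    obtain ⟨B, hB, hxB⟩ := hex
    refine ⟨B, ⟨hB, hxB⟩, ?_⟩
    rintro C ⟨hC, hxC⟩
    rcases mem_glueAt.1 hB with rfl | ⟨hB, hpB⟩ | hB <;>
      rcases mem_glueAt.1 hC with rfl | ⟨hC, hpC⟩ | hC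
    · rfl
    · have h1 := hσI C hC x hxC
      rcases mem_insert.1 hxB with rfl | h
      · omega
      · exact (hdisj C hC hpC x hxC h).elim
    · have h1 := hπI C hC x hxC
      rcases mem_insert.1 hxB with rfl | h
      · omega
      · have := hblk x h; omega
    · have h1 := hσI B hB x hxB
      rcases mem_insert.1 hxC with rfl | h
      · omega
      · exact (hdisj B hB hpB x hxB h).elim
    · exact hσ.1.eq_of_mem hC hB hxC hxB
    · have h1 := hσI B hB x hxB
      have h2 := hπI C hC x hxC
      omega
    · have h1 := hπI B hB x hxB
      rcases mem_insert.1 hxC with rfl | h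
      · omega
      · have := hblk x h; omega
    · have h1 := hσI C hC x hxC
      have h2 := hπI B hB x hxB
      omega
    · exact hπ.1.eq_of_mem hC hB hxC hxB
  · rintro B hB C hC hne ⟨x, y, z, w, hx, hy, hz, hw, hxz, hzy, hyw⟩
    have hblkmem : ∀ u ∈ blockOf σ p, blockOf σ p ∈ σ ∧ p ∈ blockOf σ p := fun u hu =>
      hσ.1.blockOf_mem (mem_Ioc.2 ⟨by have := hblk u hu; omega, le_rfl⟩)
    rcases mem_glueAt.1 hB with rfl | ⟨hB, hpB⟩ | hB <;>
      rcases mem_glueAt.1 hC with rfl | ⟨hC, hpC⟩ | hC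
    · exact hne rfl
    · have h1 := hσI C hC w hw
      have hx' : x ∈ blockOf σ p := (mem_insert.1 hx).resolve_left (by omega)
      have hy' : y ∈ blockOf σ p := (mem_insert.1 hy).resolve_left (by omega)
      exact hσ.2 _ (hblkmem x hx').1 C hC (fun e => hpC (e ▸ (hblkmem x hx').2))
        ⟨x, y, z, w, hx', hy', hz, hw, hxz, hzy, hyw⟩
    · have h1 := hπI C hC w hw
      have h2 := hπI C hC z hz
      have hy' : y ∈ blockOf σ p := (mem_insert.1 hy).resolve_left (by omega)
      have := hblk y hy'
      omega
    · have h1 := hσI B hB y hy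
      have hz' : z ∈ blockOf σ p := (mem_insert.1 hz).resolve_left (by omega)
      have hm := hblkmem z hz'
      have hyp : y ≠ p := fun e => hpB (e ▸ hy)
      exact hσ.2 B hB _ hm.1 (fun e => hpB (e ▸ hm.2))
        ⟨x, y, z, p, hx, hy, hz', hm.2, hxz, hzy, by omega⟩
    · exact hσ.2 B hB C hC hne ⟨x, y, z, w, hx, hy, hz, hw, hxz, hzy, hyw⟩
    · have h1 := hσI B hB y hy
      have h2 := hπI C hC z hz
      omega
    · have h1 := hπI B hB x hx
      have h2 := hπI B hB y hy
      have hz' : z ∈ blockOf σ p := (mem_insert.1 hz).resolve_left (by omega)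
      have := hblk z hz'
      omega
    · have h1 := hπI B hB x hx
      have h2 := hσI C hC z hz
      omega
    · exact hπ.2 B hB C hC hne ⟨x, y, z, w, hx, hy, hz, hw, hxz, hzy, hyw⟩

lemma blockOf_glueAt {a p b : ℕ} (hap : a ≤ p) (hpb : p ≤ b)
    {σ π : Finset (Finset ℕ)} (hσ : IsNCPartitionOn (Ioc a p) σ)
    (hπ : IsNCPartitionOn (Ioc p b) π) :
    blockOf (glueAt (b + 1) p σ π) (b + 1) = insert (b + 1) (blockOf σ p) :=
  (isNCPartitionOn_glueAt hap hpb hσ hπ).1.blockOf_eq (mem_glueAt.2 (Or.inl rfl))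
    (mem_insert_self _ _)

lemma prevInBlock_glueAt {a p b : ℕ} (hap : a ≤ p) (hpb : p ≤ b)
    {σ π : Finset (Finset ℕ)} (hσ : IsNCPartitionOn (Ioc a p) σ)
    (hπ : IsNCPartitionOn (Ioc p b) π) :
    prevInBlock a (b + 1) (glueAt (b + 1) p σ π) = p := by
  have hblk : ∀ x ∈ blockOf σ p, a < x ∧ x ≤ p := fun x hx =>
    mem_Ioc.1 (hσ.1.blockOf_subset p hx)
  have hset : (insert (b + 1) (blockOf σ p)).erase (b + 1) = blockOf σ p :=
    erase_insert fun h => by have := hblk _ h; omega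
  simp only [prevInBlock, blockOf_glueAt hap hpb hσ hπ, hset]
  refine le_antisymm (max'_le _ _ _ fun x hx => ?_) (le_max' _ _ ?_)
  · rcases mem_insert.1 hx with rfl | hx
    exacts [hap, (hblk x hx).2]
  · rcases hap.eq_or_lt with rfl | h
    · exact mem_insert_self _ _
    · exact mem_insert_of_mem (hσ.1.blockOf_mem (mem_Ioc.2 ⟨h, le_rfl⟩)).2

lemma restrictBlocks_glueAt_left {a p b : ℕ} (hap : a ≤ p) (hpb : p ≤ b)
    {σ π : Finset (Finset ℕ)} (hσ : IsNCPartitionOn (Ioc a p) σ)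
    (hπ : IsNCPartitionOn (Ioc p b) π) :
    restrictBlocks (Ioc a p) (glueAt (b + 1) p σ π) = σ := by
  have hg := (isNCPartitionOn_glueAt hap hpb hσ hπ).restrictBlocks
    (Ioc_subset_Ioc_right (a := a) (by omega : p ≤ b + 1))
  refine (hσ.1.eq_of_subset hg.1 fun B hB => mem_restrictBlocks.2 ⟨hσ.1.1 B hB, ?_⟩).symm
  by_cases hp : p ∈ B
  · refine ⟨_, mem_glueAt.2 (Or.inl rfl), ?_⟩
    rw [hσ.1.blockOf_eq hB hp, insert_inter_of_notMem (by simp; omega)]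
    exact inter_eq_left.2 (hσ.1.2.1 B hB)
  · exact ⟨B, mem_glueAt.2 (Or.inr (Or.inl ⟨hB, hp⟩)), inter_eq_left.2 (hσ.1.2.1 B hB)⟩

lemma restrictBlocks_glueAt_right {a p b : ℕ} (hap : a ≤ p) (hpb : p ≤ b)
    {σ π : Finset (Finset ℕ)} (hσ : IsNCPartitionOn (Ioc a p) σ)
    (hπ : IsNCPartitionOn (Ioc p b) π) :
    restrictBlocks (Ioc p b) (glueAt (b + 1) p σ π) = π := by
  have hg := (isNCPartitionOn_glueAt hap hpb hσ hπ).restrictBlocks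
    (Ioc_subset_Ioc hap (by omega : b ≤ b + 1))
  exact (hπ.1.eq_of_subset hg.1 fun B hB => mem_restrictBlocks.2
    ⟨hπ.1.1 B hB, B, mem_glueAt.2 (Or.inr (Or.inr hB)), inter_eq_left.2 (hπ.1.2.1 B hB)⟩).symm

lemma prevInBlock_mem_Icc {a b : ℕ} (hab : a ≤ b) {ρ : Finset (Finset ℕ)}
    (hρ : IsNCPartitionOn (Ioc a (b + 1)) ρ) : prevInBlock a (b + 1) ρ ∈ Icc a b := by
  rw [mem_Icc]
  refine ⟨le_max' _ _ (mem_insert_self _ _), max'_le _ _ _ fun x hx => ?_⟩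
  rcases mem_insert.1 hx with rfl | hx
  · exact hab
  · have h1 := mem_Ioc.1 (hρ.1.blockOf_subset _ (mem_erase.1 hx).2)
    have h2 := (mem_erase.1 hx).1
    omega

lemma glueAt_restrictBlocks {a b p : ℕ} (hab : a ≤ b) {ρ : Finset (Finset ℕ)}
    (hρ : IsNCPartitionOn (Ioc a (b + 1)) ρ) (hp : prevInBlock a (b + 1) ρ = p) :
    glueAt (b + 1) p (restrictBlocks (Ioc a p) ρ) (restrictBlocks (Ioc p b) ρ) = ρ := by
  have hpI := prevInBlock_mem_Icc hab hρ
  rw [hp, mem_Icc] at hpI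
  obtain ⟨hap, hpb⟩ := hpI
  have hσ := hρ.restrictBlocks (Ioc_subset_Ioc_right (a := a) (by omega : p ≤ b + 1))
  have hπ := hρ.restrictBlocks (Ioc_subset_Ioc hap (by omega : b ≤ b + 1))
  obtain ⟨hB, hnB⟩ := hρ.1.blockOf_mem (x := b + 1) (mem_Ioc.2 ⟨by omega, le_rfl⟩)
  have hpmem : p = a ∨ p ∈ blockOf ρ (b + 1) := by
    have h := max'_mem _ (insert_nonempty a ((blockOf ρ (b + 1)).erase (b + 1)))
    rw [show max' _ _ = p from hp] at h
    exact (mem_insert.1 h).imp id fun h => (mem_erase.1 h).2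
  have hle : ∀ x ∈ blockOf ρ (b + 1), x ≠ b + 1 → x ≤ p := fun x hx hne => by
    rw [← hp]
    exact le_max' _ _ (mem_insert_of_mem (mem_erase.2 ⟨hne, hx⟩))
  generalize blockOf ρ (b + 1) = B at hB hnB hpmem hle
  have hI : ∀ C ∈ ρ, ∀ x ∈ C, a < x ∧ x ≤ b + 1 := fun C hC x hx =>
    mem_Ioc.1 (hρ.1.2.1 C hC hx)
  have hside : ∀ C ∈ ρ, C ≠ B → ∀ x ∈ C, ∀ y ∈ C, x ≤ p → y ≤ p := by
    intro C hC hne x hx y hy hxp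
    by_contra hyp
    have h1 := hI C hC x hx
    have h2 := hI C hC y hy
    have hpB : p ∈ B := hpmem.resolve_left (by omega)
    have hpC : p ∉ C := fun h => hne (hρ.1.eq_of_mem hC hB h hpB)
    have hxp' : x ≠ p := fun e => hpC (e ▸ hx)
    have hy' : y ≠ b + 1 := fun e => hne (hρ.1.eq_of_mem hC hB hy (e ▸ hnB))
    exact hρ.2 C hC B hB hne ⟨x, y, p, b + 1, hx, hy, hpB, hnB, by omega, by omega, by omega⟩
  refine (isNCPartitionOn_glueAt hap hpb hσ hπ).1.eq_of_subset hρ.1 fun D hD => ?_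
  rcases mem_glueAt.1 hD with rfl | ⟨hD, hpD⟩ | hD
  · suffices h : blockOf (restrictBlocks (Ioc a p) ρ) p = B ∩ Ioc a p by
      convert hB using 1
      rw [h]
      ext x
      simp only [mem_insert, mem_inter, mem_Ioc]
      constructor
      · rintro (rfl | h)
        exacts [hnB, h.1]
      · intro hx
        by_cases hxn : x = b + 1
        · exact Or.inl hxn
        · exact Or.inr ⟨hx, (hI B hB x hx).1, hle x hx hxn⟩
    rcases hap.eq_or_lt with rfl | hlt
    · rw [hσ.1.blockOf_eq_empty (by simp)]
      simp
    · have hpB : p ∈ B ∩ Ioc a p :=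
        mem_inter.2 ⟨hpmem.resolve_left (by omega), mem_Ioc.2 ⟨hlt, le_rfl⟩⟩
      exact hσ.1.blockOf_eq (mem_restrictBlocks.2 ⟨⟨p, hpB⟩, B, hB, rfl⟩) hpB
  · obtain ⟨⟨x, hx⟩, C, hC, rfl⟩ := mem_restrictBlocks.1 hD
    obtain ⟨hxC, hxI⟩ := mem_inter.1 hx
    rw [mem_Ioc] at hxI
    have hne : C ≠ B := by
      rintro rfl
      exact hpD (mem_inter.2 ⟨hpmem.resolve_left (by omega), mem_Ioc.2 ⟨by omega, le_rfl⟩⟩)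
    rwa [inter_eq_left.2 fun y hy =>
      mem_Ioc.2 ⟨(hI C hC y hy).1, hside C hC hne x hxC y hy hxI.2⟩]
  · obtain ⟨⟨x, hx⟩, C, hC, rfl⟩ := mem_restrictBlocks.1 hD
    obtain ⟨hxC, hxI⟩ := mem_inter.1 hx
    rw [mem_Ioc] at hxI
    have hne : C ≠ B := by
      rintro rfl
      have := hle x hxC (by omega)
      omega
    rwa [inter_eq_left.2 fun y hy => ?_]
    have h1 := hI C hC y hy
    have h2 : y ≠ b + 1 := fun e => hne (hρ.1.eq_of_mem hC hB hy (e ▸ hnB))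
    have h3 : ¬ y ≤ p := fun h => by
      have := hside C hC hne y hy x hxC h
      omega
    rw [mem_Ioc]
    omega

lemma sum_ncPartitions_Ioc_succ {M : Type*} [AddCommMonoid M] {a b : ℕ} (hab : a ≤ b)
    (f : Finset (Finset ℕ) → M) :
    ∑ ρ ∈ ncPartitions (Ioc a (b + 1)), f ρ =
      ∑ p ∈ Icc a b, ∑ σ ∈ ncPartitions (Ioc a p), ∑ π ∈ ncPartitions (Ioc p b),
        f (glueAt (b + 1) p σ π) := by
  rw [← sum_fiberwise_of_maps_to
    (fun ρ hρ => prevInBlock_mem_Icc hab (mem_ncPartitions.1 hρ)) f]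
  refine sum_congr rfl fun p hp => ?_
  obtain ⟨hap, hpb⟩ := mem_Icc.1 hp
  rw [← sum_product']
  refine sum_bij' (fun ρ _ => (restrictBlocks (Ioc a p) ρ, restrictBlocks (Ioc p b) ρ))
    (fun x _ => glueAt (b + 1) p x.1 x.2) ?_ ?_ ?_ ?_ ?_
  · intro ρ hρ
    rw [mem_filter, mem_ncPartitions] at hρ
    rw [mem_product, mem_ncPartitions, mem_ncPartitions]
    exact ⟨hρ.1.restrictBlocks (Ioc_subset_Ioc_right (by omega)),
      hρ.1.restrictBlocks (Ioc_subset_Ioc hap (by omega))⟩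
  · rintro ⟨σ, π⟩ hx
    rw [mem_product, mem_ncPartitions, mem_ncPartitions] at hx
    rw [mem_filter, mem_ncPartitions]
    exact ⟨isNCPartitionOn_glueAt hap hpb hx.1 hx.2, prevInBlock_glueAt hap hpb hx.1 hx.2⟩
  · intro ρ hρ
    rw [mem_filter, mem_ncPartitions] at hρ
    exact glueAt_restrictBlocks hab hρ.1 hρ.2
  · rintro ⟨σ, π⟩ hx
    rw [mem_product, mem_ncPartitions, mem_ncPartitions] at hx
    exact Prod.ext (restrictBlocks_glueAt_left hap hpb hx.1 hx.2)
      (restrictBlocks_glueAt_right hap hpb hx.1 hx.2)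
  · intro ρ hρ
    rw [mem_filter, mem_ncPartitions] at hρ
    rw [glueAt_restrictBlocks hab hρ.1 hρ.2]

end Partitions

section Weights

variable {R : Type*} [CommSemiring R]

/-- The product of `κ |B|` over the blocks `B` of `ρ`, except that the block containing `n`
contributes `κ (|B| + j)`. -/
noncomputable def blockWeight (κ : ℕ → R) (j n : ℕ) (ρ : Finset (Finset ℕ)) : R :=
  κ ((blockOf ρ n).card + j) * ∏ B ∈ ρ.filter (n ∉ ·), κ B.card

/-- The sum of `blockWeight κ j b` over the non-crossing partitions of `{a + 1, …, b}`. -/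
noncomputable def weightSum (κ : ℕ → R) (j a b : ℕ) : R :=
  ∑ ρ ∈ ncPartitions (Ioc a b), blockWeight κ j b ρ

lemma blockWeight_zero {κ : ℕ → R} (hκ : κ 0 = 1) {a b : ℕ} (hab : a ≤ b)
    {ρ : Finset (Finset ℕ)} (hρ : IsNCPartitionOn (Ioc a b) ρ) :
    blockWeight κ 0 b ρ = ∏ B ∈ ρ, κ B.card := by
  rw [blockWeight, ← prod_filter_mul_prod_filter_not ρ (b ∈ ·), add_zero]
  congr 1
  rcases hab.eq_or_lt with rfl | h
  · rw [hρ.1.blockOf_eq_empty (by simp), card_empty, hκ, filter_false_of_mem, prod_empty]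
    intro B hB h
    simpa using hρ.1.2.1 B hB h
  · obtain ⟨hB, hbB⟩ := hρ.1.blockOf_mem (mem_Ioc.2 ⟨h, le_rfl⟩)
    have : ρ.filter (b ∈ ·) = {blockOf ρ b} := by
      ext C
      rw [mem_filter, mem_singleton]
      constructor
      · exact fun hC => hρ.1.eq_of_mem hC.1 hB hC.2 hbB
      · rintro rfl
        exact ⟨hB, hbB⟩
    rw [this, prod_singleton]

lemma blockWeight_glueAt (κ : ℕ → R) (j : ℕ) {a p b : ℕ} (hap : a ≤ p) (hpb : p ≤ b)
    {σ π : Finset (Finset ℕ)} (hσ : IsNCPartitionOn (Ioc a p) σ)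
    (hπ : IsNCPartitionOn (Ioc p b) π) :
    blockWeight κ j (b + 1) (glueAt (b + 1) p σ π) =
      blockWeight κ (j + 1) p σ * ∏ B ∈ π, κ B.card := by
  have hblk : b + 1 ∉ blockOf σ p := fun h => by
    have := mem_Ioc.1 (hσ.1.blockOf_subset p h)
    omega
  have hdisj : Disjoint (σ.filter (p ∉ ·)) π := by
    rw [disjoint_left]
    intro B hB hB'
    obtain ⟨x, hx⟩ := hπ.1.1 B hB'
    have h1 := mem_Ioc.1 (hπ.1.2.1 B hB' hx)
    have h2 := mem_Ioc.1 (hσ.1.2.1 B (mem_filter.1 hB).1 hx)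
    omega
  have hfil : (glueAt (b + 1) p σ π).filter (b + 1 ∉ ·) = σ.filter (p ∉ ·) ∪ π := by
    rw [glueAt, filter_insert, if_neg (by simp), filter_true_of_mem]
    intro B hB hb
    rcases mem_union.1 hB with hB | hB
    · have := mem_Ioc.1 (hσ.1.2.1 B (mem_filter.1 hB).1 hb)
      omega
    · have := mem_Ioc.1 (hπ.1.2.1 B hB hb)
      omega
  rw [blockWeight, blockOf_glueAt hap hpb hσ hπ, card_insert_of_notMem hblk, hfil,
    prod_union hdisj, blockWeight, mul_assoc, add_right_comm, add_assoc]

lemma weightSum_self (κ : ℕ → R) (j a : ℕ) : weightSum κ j a a = κ j := by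
  have h : ncPartitions (Ioc a a) = {∅} := by
    ext ρ
    rw [mem_ncPartitions, mem_singleton]
    constructor
    · intro h
      refine eq_empty_of_forall_notMem fun B hB => ?_
      obtain ⟨x, hx⟩ := h.1.1 B hB
      simpa using h.1.2.1 B hB hx
    · rintro rfl
      simp [IsNCPartitionOn, IsPartitionOn, IsNoncrossing]
  rw [weightSum, h, sum_singleton]
  simp [blockWeight, blockOf]

lemma weightSum_succ {κ : ℕ → R} (hκ : κ 0 = 1) (j a n : ℕ) :
    weightSum κ j a (a + n + 1) =
      ∑ i ∈ range (n + 1), weightSum κ (j + 1) a (a + i) * weightSum κ 0 (a + i) (a + n) := by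
  rw [weightSum, sum_ncPartitions_Ioc_succ (by omega : a ≤ a + n)]
  have hI : Icc a (a + n) = (range (n + 1)).image (a + ·) := by
    ext x
    simp only [mem_Icc, mem_image, mem_range]
    exact ⟨fun h => ⟨x - a, by omega, by omega⟩, by rintro ⟨i, hi, rfl⟩; omega⟩
  rw [hI, sum_image (by intro x _ y _ h; simpa using h)]
  refine sum_congr rfl fun i hi => ?_
  have hi' : a + i ≤ a + n := by
    rw [mem_range] at hi
    omega
  rw [weightSum, weightSum, sum_mul_sum]
  refine sum_congr rfl fun σ hσ => sum_congr rfl fun π hπ => ?_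
  rw [mem_ncPartitions] at hσ hπ
  rw [blockWeight_glueAt κ j (by omega) hi' hσ hπ, blockWeight_zero hκ hi' hπ]

lemma weightSum_add_left {κ : ℕ → R} (hκ : κ 0 = 1) (n j a : ℕ) :
    weightSum κ j a (a + n) = weightSum κ j 0 n := by
  induction n using Nat.strong_induction_on generalizing j a with
  | _ n ih =>
    cases n with
    | zero => rw [add_zero, weightSum_self, weightSum_self]
    | succ n =>
      have h0 := weightSum_succ hκ j 0 n
      rw [zero_add] at h0
      rw [← add_assoc, weightSum_succ hκ, h0]
      refine sum_congr rfl fun i hi => ?_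
      rw [mem_range] at hi
      have h1 := ih (n - i) (by omega) 0 (a + i)
      have h2 := ih (n - i) (by omega) 0 i
      rw [show a + i + (n - i) = a + n by omega] at h1
      rw [show i + (n - i) = n by omega] at h2
      simp only [zero_add]
      rw [ih i (by omega), h1, h2]

lemma weightSum_recursion {κ : ℕ → R} (hκ : κ 0 = 1) (j n : ℕ) :
    weightSum κ j 0 (n + 1) =
      ∑ x ∈ antidiagonal n, weightSum κ 0 0 x.1 * weightSum κ (j + 1) 0 x.2 := by
  have h0 := weightSum_succ hκ j 0 n
  rw [zero_add] at h0
  rw [h0, ← Nat.sum_antidiagonal_eq_sum_range_succ_mk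
    (fun x : ℕ × ℕ => weightSum κ (j + 1) 0 (0 + x.1) * weightSum κ 0 (0 + x.1) n),
    ← Nat.sum_antidiagonal_swap]
  refine sum_congr rfl fun x hx => ?_
  rw [HasAntidiagonal.mem_antidiagonal] at hx
  simp only [zero_add, Prod.fst_swap]
  rw [mul_comm, ← hx, add_comm x.1 x.2, weightSum_add_left hκ]

lemma NCFinset_eq (k : ℕ) : NCFinset k = ncPartitions (Ioc 0 k) := by
  rw [NCFinset, ncPartitions]
  rfl

lemma weightSum_zero {κ : ℕ → R} (hκ : κ 0 = 1) (k : ℕ) :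
    weightSum κ 0 0 k = ∑ ρ ∈ NCFinset k, ∏ B ∈ ρ, κ B.card := by
  rw [NCFinset_eq, weightSum]
  exact sum_congr rfl fun ρ hρ => blockWeight_zero hκ (Nat.zero_le k) (mem_ncPartitions.1 hρ)

end Weights

section Series

open PowerSeries in
/-- If `H j = X * N * H (j + 1)` for all `j`, then every `H j` vanishes. -/
lemma powerSeries_eq_zero_of_recursion {K : Type*} [CommRing K] (N : K⟦X⟧) (H : ℕ → K⟦X⟧)
    (hH : ∀ j, H j = X * N * H (j + 1)) (j : ℕ) : H j = 0 := by
  have hdvd : ∀ i j, (X : K⟦X⟧) ^ i ∣ H j := by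
    intro i
    induction i with
    | zero => simp
    | succ i ih =>
      intro j
      rw [hH j, pow_succ', mul_assoc]
      exact mul_dvd_mul_left _ ((ih (j + 1)).mul_left N)
  ext n
  simpa using X_pow_dvd_iff.1 (hdvd (n + 1) j) n (Nat.lt_succ_self n)

open PowerSeries in
/-- Relation between two infinitesimal variations of the solution of the recursion
`F j = κ j + X * F 0 * F (j + 1)`: the derivative in `X`, and the variation `D` obtained by
scaling every `κ j` with `j ≥ 1`. -/
lemma powerSeries_variation {K : Type*} [CommRing K] (κ : ℕ → K) (F D : ℕ → K⟦X⟧)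
    (hκ : κ 0 = 1)
    (hF : ∀ j, F j = C (κ j) + X * F 0 * F (j + 1))
    (hD0 : D 0 = X * D 0 * F 1 + X * F 0 * D 1)
    (hD : ∀ j, D (j + 1) =
      C (κ (j + 1)) + X * D 0 * F (j + 2) + X * F 0 * D (j + 2)) :
    D 0 * F 0 = (F 0 - 1) * (F 0 + X * d⁄dX K (F 0)) := by
  set W : K⟦X⟧ := F 0 + X * d⁄dX K (F 0) with hW
  have hF' : ∀ j, d⁄dX K (F j) = W * F (j + 1) + X * F 0 * d⁄dX K (F (j + 1)) := by
    intro j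
    conv_lhs => rw [hF j]
    simp only [map_add, Derivation.leibniz, derivative_C, derivative_X, smul_eq_mul, hW]
    ring
  have key : ∀ j, W * D (j + 1) - X * D 0 * d⁄dX K (F (j + 1)) - W * F (j + 1) = 0 := by
    refine powerSeries_eq_zero_of_recursion (F 0)
      (fun j => W * D (j + 1) - X * D 0 * d⁄dX K (F (j + 1)) - W * F (j + 1)) fun j => ?_
    linear_combination W * hD j - X * D 0 * hF' (j + 1) - W * hF (j + 1)
  have h0 := hF 0
  rw [hκ, map_one] at h0
  linear_combination W * hD0 - X * D 0 * hF' 0 + X * F 0 * key 0 - W * h0 - D 0 * hW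

end Series

section DualNumbers

/-- The dual number valued weights `(1 + ε) • fc j`, normalised to be `1` at `j = 0`. -/
noncomputable def dualWeight (fc : ℕ → ℝ) (j : ℕ) : DualNumber ℝ :=
  if j = 0 then 1 else TrivSqZeroExt.inl (fc j) * (1 + DualNumber.eps)

lemma prod_dualWeight (fc : ℕ → ℝ) (ρ : Finset (Finset ℕ)) (hρ : ∀ B ∈ ρ, B.Nonempty) :
    ∏ B ∈ ρ, dualWeight fc B.card =
      TrivSqZeroExt.inl (∏ B ∈ ρ, fc B.card) +
        TrivSqZeroExt.inr ((ρ.card : ℝ) * ∏ B ∈ ρ, fc B.card) := by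
  induction ρ using Finset.induction_on with
  | empty => ext <;> simp
  | insert B ρ hB ih =>
    have hne : B.card ≠ 0 := (card_pos.2 (hρ B (mem_insert_self _ _))).ne'
    rw [prod_insert hB, prod_insert hB, card_insert_of_notMem hB,
      ih fun C hC => hρ C (mem_insert_of_mem hC), dualWeight, if_neg hne]
    ext
    · simp
    · simp
      ring

lemma weightSum_dualWeight (fc : ℕ → ℝ) (k : ℕ) :
    (weightSum (dualWeight fc) 0 0 k).fst = ∑ ρ ∈ NCFinset k, ∏ B ∈ ρ, fc B.card ∧
    (weightSum (dualWeight fc) 0 0 k).snd =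
      ∑ ρ ∈ NCFinset k, (ρ.card : ℝ) * ∏ B ∈ ρ, fc B.card := by
  have h : weightSum (dualWeight fc) 0 0 k = ∑ ρ ∈ NCFinset k,
      (TrivSqZeroExt.inl (∏ B ∈ ρ, fc B.card) +
        TrivSqZeroExt.inr ((ρ.card : ℝ) * ∏ B ∈ ρ, fc B.card)) := by
    rw [weightSum_zero (by simp [dualWeight])]
    refine sum_congr rfl fun ρ hρ => prod_dualWeight fc ρ ?_
    exact (mem_filter.1 hρ).2.1.1
  rw [h]
  constructor
  · rw [TrivSqZeroExt.fst_sum]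
    simp
  · rw [TrivSqZeroExt.snd_sum]
    simp

open PowerSeries in
/-- The generating series of `Σ |ρ| fc_ρ` in terms of the generating series of `Σ fc_ρ`. -/
lemma powerSeries_card_mul (fc : ℕ → ℝ) :
    (mk fun k => ∑ ρ ∈ NCFinset k, (ρ.card : ℝ) * ∏ B ∈ ρ, fc B.card) *
        (mk fun k => ∑ ρ ∈ NCFinset k, ∏ B ∈ ρ, fc B.card) =
      ((mk fun k => ∑ ρ ∈ NCFinset k, ∏ B ∈ ρ, fc B.card) - 1) *
        ((mk fun k => ∑ ρ ∈ NCFinset k, ∏ B ∈ ρ, fc B.card) +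
          X * d⁄dX ℝ (mk fun k => ∑ ρ ∈ NCFinset k, ∏ B ∈ ρ, fc B.card)) := by
  have hκ : dualWeight fc 0 = 1 := by simp [dualWeight]
  set F : ℕ → ℝ⟦X⟧ := fun j => mk fun n => (weightSum (dualWeight fc) j 0 n).fst with hFdef
  set D : ℕ → ℝ⟦X⟧ := fun j => mk fun n => (weightSum (dualWeight fc) j 0 n).snd with hDdef
  have hF0 : (mk fun k => ∑ ρ ∈ NCFinset k, ∏ B ∈ ρ, fc B.card) = F 0 := by
    ext n
    simp [hFdef, (weightSum_dualWeight fc n).1]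
  have hD0 : (mk fun k => ∑ ρ ∈ NCFinset k, (ρ.card : ℝ) * ∏ B ∈ ρ, fc B.card) = D 0 := by
    ext n
    simp [hDdef, (weightSum_dualWeight fc n).2]
  have hF : ∀ j, F j = C (dualWeight fc j).fst + X * F 0 * F (j + 1) := by
    intro j
    ext n
    cases n with
    | zero => simp [hFdef, weightSum_self, mul_assoc]
    | succ n =>
      rw [mul_assoc, map_add, coeff_succ_X_mul, coeff_mul, coeff_C, if_neg n.succ_ne_zero]
      simp [hFdef, weightSum_recursion hκ, TrivSqZeroExt.fst_sum]
  have hD : ∀ j, D j = C (dualWeight fc j).snd + X * D 0 * F (j + 1) + X * F 0 * D (j + 1) := by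
    intro j
    ext n
    cases n with
    | zero => simp [hDdef, weightSum_self, mul_assoc]
    | succ n =>
      rw [mul_assoc, mul_assoc, map_add, map_add, coeff_succ_X_mul, coeff_succ_X_mul, coeff_mul,
        coeff_mul, coeff_C, if_neg n.succ_ne_zero, zero_add, ← sum_add_distrib]
      simp only [hFdef, hDdef, weightSum_recursion hκ, TrivSqZeroExt.snd_sum, coeff_mk]
      refine sum_congr rfl fun x _ => ?_
      simp
      ring
  have hsnd : ∀ j, (dualWeight fc (j + 1)).snd = (dualWeight fc (j + 1)).fst := by
    intro j
    simp [dualWeight]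
  rw [hF0, hD0]
  refine powerSeries_variation (fun j => (dualWeight fc j).fst) F D (by simp [hκ]) hF ?_ ?_
  · have := hD 0
    simpa [hκ] using this
  · intro j
    rw [← hsnd]
    exact hD (j + 1)

end DualNumbers

/-- Let `m` be a probability measure on `ℝ` with finite moments of all
orders, `fc` its free cumulants, and `Mτ k` the moments of the Rayleigh measure `τ`
associated with `m` by the Markov–Krein correspondence.  Then for every `k ≥ 1`,
`Σ_{ρ ∈ NC(k)} (|ρ| − 1)·fc_ρ(m) = Σ_{r=1}^{k−1} Mτ r · M_{k−r}(m)`. -/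
theorem statement1
    (m : Measure ℝ) [IsProbabilityMeasure m]
    (hmom : ∀ n : ℕ, Integrable (fun x => x ^ n) m)
    (fc : ℕ → ℝ)
    (hfc : ∀ k : ℕ, 1 ≤ k →
      (∫ x, x ^ k ∂m) = ∑ ρ ∈ NCFinset k, ∏ B ∈ ρ, fc B.card)
    (Mτ : ℕ → ℝ)
    (hMτ : ∀ k : ℕ, 1 ≤ k →
      Mτ k = k * (∫ x, x ^ k ∂m) - ∑ r ∈ Finset.Ico 1 k, Mτ r * (∫ x, x ^ (k - r) ∂m))
    (k : ℕ) (hk : 1 ≤ k) :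
    ∑ ρ ∈ NCFinset k, ((ρ.card : ℝ) - 1) * ∏ B ∈ ρ, fc B.card
      = ∑ r ∈ Finset.Ico 1 k, Mτ r * (∫ x, x ^ (k - r) ∂m) := by
  have hvar := powerSeries_card_mul fc
  have hM0 : ∑ ρ ∈ NCFinset 0, ∏ B ∈ ρ, fc B.card = 1 := by
    rw [← (weightSum_dualWeight fc 0).1, weightSum_self]
    simp [dualWeight]
  have hM : ∀ n, ∑ ρ ∈ NCFinset n, ∏ B ∈ ρ, fc B.card = ∫ x, x ^ n ∂m := by
    intro n
    rcases Nat.eq_zero_or_pos n with rfl | hn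
    · simp [hM0]
    · exact (hfc n hn).symm
  simp only [hM] at hvar
  generalize hMu : (fun n : ℕ => ∫ x, x ^ n ∂m) = μ at hvar
  have hμ : ∀ n : ℕ, ∫ x, x ^ n ∂m = μ n := fun n => congrFun hMu n
  simp only [hμ] at hM hMτ ⊢
  have hμ0 : μ 0 = 1 := by rw [← hM, hM0]
  have hsplit : ∀ n, 1 ≤ n → ∀ g : ℕ → ℝ, g 0 = 0 →
      ∑ x ∈ antidiagonal n, g x.1 * μ x.2 = g n + ∑ r ∈ Ico 1 n, g r * μ (n - r) := by
    intro n hn g hg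
    rw [Nat.sum_antidiagonal_eq_sum_range_succ_mk, sum_range_succ, Nat.sub_self, hμ0, mul_one,
      add_comm, range_eq_Ico, sum_eq_sum_Ico_succ_bot hn, hg, zero_mul, zero_add]
  set T : ℕ → ℝ := fun n => if n = 0 then 0 else Mτ n with hT
  have hTsum : ∀ n, ∑ r ∈ Ico 1 n, T r * μ (n - r) = ∑ r ∈ Ico 1 n, Mτ r * μ (n - r) := by
    intro n
    refine sum_congr rfl fun r hr => ?_
    have hr0 : r ≠ 0 := by
      have := (mem_Ico.1 hr).1
      omega
    simp only [hT, if_neg hr0]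
  have hder : PowerSeries.X * PowerSeries.derivative ℝ (PowerSeries.mk μ) =
      PowerSeries.mk T * PowerSeries.mk μ := by
    ext n
    rcases Nat.eq_zero_or_pos n with rfl | hn
    · simp [hT]
    · rw [PowerSeries.coeff_mul n (PowerSeries.mk T)]
      simp only [PowerSeries.coeff_mk]
      rw [hsplit n hn T (by simp [hT]), hTsum]
      obtain ⟨l, rfl⟩ : ∃ l, n = l + 1 := ⟨n - 1, by omega⟩
      rw [PowerSeries.coeff_succ_X_mul, PowerSeries.coeff_derivative, PowerSeries.coeff_mk]
      have := hMτ (l + 1) hn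
      simp only [hT, if_neg l.succ_ne_zero]
      rw [this]
      push_cast
      ring
  have hne : PowerSeries.mk μ ≠ 0 := fun h => by
    have := congrArg (PowerSeries.coeff 0) h
    simp [hμ0] at this
  rw [hder] at hvar
  have hcancel : (PowerSeries.mk fun k => ∑ ρ ∈ NCFinset k, (ρ.card : ℝ) * ∏ B ∈ ρ, fc B.card) =
      PowerSeries.mk μ - 1 + (PowerSeries.mk T * PowerSeries.mk μ - PowerSeries.mk T) :=
    mul_right_cancel₀ hne (by rw [hvar]; ring)
  have hcoeff := congrArg (PowerSeries.coeff k) hcancel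
  simp only [map_add, map_sub, PowerSeries.coeff_mul, PowerSeries.coeff_mk, PowerSeries.coeff_one,
    if_neg (show k ≠ 0 by omega)] at hcoeff
  rw [hsplit k hk T (by simp [hT]), hTsum] at hcoeff
  simp only [sub_mul, one_mul, sum_sub_distrib]
  rw [hcoeff, hM]
  ring
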